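/- The set of trivial S_n-invariants of the splitting algebra A_f equals the image of algebraMap A A_f. -/

import Mathlib

open MvPolynomial

noncomputable section

/-- The ideal defining the splitting algebra of `f = Xⁿ + a₁Xⁿ⁻¹ + ⋯ + aₙ`. -/
def splittingIdeal (A : Type*) [CommRing A] (n : ℕ) (a : Fin n → A) :
    Ideal (MvPolynomial (Fin n) A) :=
  Ideal.span (Set.range fun k : Fin n =>
    esymm (Fin n) A (k.1 + 1) - C ((-1 : A) ^ (k.1 + 1) * a k))

/-- The splitting algebra `A_f`. -/
abbrev SplittingAlg (A : Type*) [CommRing A] (n : ℕ) (a : Fin n → A) : Type _ :=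
  MvPolynomial (Fin n) A ⧸ splittingIdeal A n a

/-- The quotient map `π`. -/
def splittingMk (A : Type*) [CommRing A] (n : ℕ) (a : Fin n → A) :
    MvPolynomial (Fin n) A →ₐ[A] SplittingAlg A n a :=
  Ideal.Quotient.mkₐ A (splittingIdeal A n a)

/-- The universal roots `τᵢ`. -/
def tau (A : Type*) [CommRing A] (n : ℕ) (a : Fin n → A) (i : Fin n) :
    SplittingAlg A n a :=
  splittingMk A n a (X i)

theorem rename_mem_splittingIdeal (A : Type*) [CommRing A] (n : ℕ) (a : Fin n → A)
    (σ : Equiv.Perm (Fin n)) {p : MvPolynomial (Fin n) A}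
    (hp : p ∈ splittingIdeal A n a) :
    rename (σ : Fin n → Fin n) p ∈ splittingIdeal A n a := by
  have h : (splittingIdeal A n a).map ((rename (σ : Fin n → Fin n)).toRingHom :
      MvPolynomial (Fin n) A →+* MvPolynomial (Fin n) A) ≤ splittingIdeal A n a := by
    rw [splittingIdeal, Ideal.map_span]
    refine Ideal.span_le.2 ?_
    rintro _ ⟨_, ⟨k, rfl⟩, rfl⟩
    have hren : (rename (σ : Fin n → Fin n))
        (esymm (Fin n) A (k.1 + 1) - C ((-1 : A) ^ (k.1 + 1) * a k))
        = esymm (Fin n) A (k.1 + 1) - C ((-1 : A) ^ (k.1 + 1) * a k) := by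
      rw [map_sub, esymm_isSymmetric (Fin n) A (k.1 + 1) σ, rename_C]
    show (rename (σ : Fin n → Fin n))
        (esymm (Fin n) A (k.1 + 1) - C ((-1 : A) ^ (k.1 + 1) * a k)) ∈ _
    rw [hren]
    exact Ideal.subset_span ⟨k, rfl⟩
  exact h (Ideal.mem_map_of_mem _ hp)

/-- The action of a permutation `σ` on the splitting algebra, as an `A`-algebra map. -/
def permHom (A : Type*) [CommRing A] (n : ℕ) (a : Fin n → A) (σ : Equiv.Perm (Fin n)) :
    SplittingAlg A n a →ₐ[A] SplittingAlg A n a :=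
  Ideal.Quotient.liftₐ (splittingIdeal A n a)
    ((splittingMk A n a).comp (rename (σ : Fin n → Fin n)))
    (fun p hp => by
      have h := rename_mem_splittingIdeal A n a σ hp
      show Ideal.Quotient.mkₐ A (splittingIdeal A n a) _ = 0
      rw [Ideal.Quotient.mkₐ_eq_mk]
      exact (Ideal.Quotient.eq_zero_iff_mem).2 h)

/-- The trivial `G`-invariants of the splitting algebra. -/
def trivialInv (A : Type*) [CommRing A] (n : ℕ) (a : Fin n → A)
    (G : Subgroup (Equiv.Perm (Fin n))) : Set (SplittingAlg A n a) :=
  splittingMk A n a '' {p | ∀ σ ∈ G, rename (σ : Fin n → Fin n) p = p}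

/-- The element `D_f = ∏_{i<j} (τᵢ + τⱼ)`. -/
def Df (A : Type*) [CommRing A] (n : ℕ) (a : Fin n → A) : SplittingAlg A n a :=
  ∏ p ∈ Finset.univ.filter (fun p : Fin n × Fin n => p.1 < p.2),
    (tau A n a p.1 + tau A n a p.2)

end

theorem splittingMk_esymm (A : Type*) [CommRing A] (n : ℕ) (a : Fin n → A) (k : Fin n) :
    splittingMk A n a (esymm (Fin n) A (k.1 + 1))
      = algebraMap A (SplittingAlg A n a) ((-1 : A) ^ (k.1 + 1) * a k) := by
  rw [← (splittingMk A n a).commutes]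
  exact Ideal.Quotient.eq.2 (Ideal.subset_span ⟨k, rfl⟩)

theorem splittingMk_esymmAlgHom (A : Type*) [CommRing A] (n : ℕ) (a : Fin n → A)
    (q : MvPolynomial (Fin n) A) :
    splittingMk A n a (esymmAlgHom (Fin n) A n q : MvPolynomial (Fin n) A)
      = algebraMap A (SplittingAlg A n a)
          (aeval (fun k : Fin n => (-1 : A) ^ (k.1 + 1) * a k) q) := by
  have h : ((splittingMk A n a).comp (symmetricSubalgebra (Fin n) A).val).comp
        (esymmAlgHom (Fin n) A n)
      = (Algebra.ofId A (SplittingAlg A n a)).comp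
          (aeval fun k : Fin n => (-1 : A) ^ (k.1 + 1) * a k) := by
    refine MvPolynomial.algHom_ext fun k => ?_
    simpa [esymmAlgHom, Algebra.ofId_apply] using splittingMk_esymm A n a k
  exact DFunLike.congr_fun h q

/-- The set of trivial `S_n`-invariants of `A_f` equals the image of
`algebraMap A A_f`. -/
theorem trivialInv_top_eq_range (A : Type*) [CommRing A] (n : ℕ) (hn : 1 ≤ n)
    (a : Fin n → A) :
    trivialInv A n a (⊤ : Subgroup (Equiv.Perm (Fin n)))
      = Set.range (algebraMap A (SplittingAlg A n a)) := by
  ext x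
  constructor
  · rintro ⟨p, hp, rfl⟩
    obtain ⟨q, hq⟩ := esymmAlgHom_surjective A (Fintype.card_fin n).le
      (⟨p, fun σ => hp σ trivial⟩ : symmetricSubalgebra (Fin n) A)
    refine ⟨_, (splittingMk_esymmAlgHom A n a q).symm.trans ?_⟩
    rw [hq]
  · rintro ⟨c, rfl⟩
    exact ⟨C c, fun σ _ => rename_C _ c, (splittingMk A n a).commutes c⟩
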